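/- Let u be a smooth uniformly convex solution of the second boundary value problem with data (f, c), i.e. u ∈ C^∞(Ω̄), D²u ≥ δ·Iₙ on Ω̄ for some δ > 0, |∇u| < 1, div(∇u/√(1 − |∇u|²)) = f(x, ∇u) + c in Ω and ∇u(Ω) = Ω̃. Then the boundary condition is oblique: for every x ∈ ∂Ω, ⟨∇h(∇u(x)), ν(x)⟩ ≥ 0, where ν(x) = ∇h̃(x) is the inner unit normal of ∂Ω at x. -/

import Mathlib

open Set MeasureTheory Matrix
open scoped Topology RealInnerProductSpace NNReal

noncomputable section

abbrev Euc (n : ℕ) := EuclideanSpace ℝ (Fin n)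

variable {n : ℕ}

/-- Hessian matrix of `u` at `x`. -/
def Hess (u : Euc n → ℝ) (x : Euc n) : Matrix (Fin n) (Fin n) ℝ :=
  fun i j => iteratedFDeriv ℝ 2 u x ![EuclideanSpace.single i 1, EuclideanSpace.single j 1]

/-- `A ≤ B` in the sense of symmetric matrices. -/
def MatLE (A B : Matrix (Fin n) (Fin n) ℝ) : Prop := (B - A).PosSemidef

/-- The Minkowski mean-curvature operator `div (∇u / √(1 - |∇u|²))`. -/
def MinkDiv (u : Euc n → ℝ) (x : Euc n) : ℝ :=
  ∑ i, fderiv ℝ (fun y => (Real.sqrt (1 - ‖gradient u y‖ ^ 2))⁻¹ * gradient u y i) x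
    (EuclideanSpace.single i 1)

/-- The Euclidean mean-curvature operator `div (∇u / √(1 + |∇u|²))`. -/
def EucDiv (u : Euc n → ℝ) (x : Euc n) : ℝ :=
  ∑ i, fderiv ℝ (fun y => (Real.sqrt (1 + ‖gradient u y‖ ^ 2))⁻¹ * gradient u y i) x
    (EuclideanSpace.single i 1)

/-- `S(p) = (1/v)(Iₙ + p pᵀ / v²)`, `v = √(1-|p|²)`. -/
def Smat (p : Euc n) : Matrix (Fin n) (Fin n) ℝ :=
  (Real.sqrt (1 - ‖p‖ ^ 2))⁻¹ •
    ((1 : Matrix (Fin n) (Fin n) ℝ) +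
      (1 - ‖p‖ ^ 2)⁻¹ • Matrix.vecMulVec (fun i => p i) (fun j => p j))

/-- `B(p) = Iₙ + p pᵀ / (v (1 + v))`, `v = √(1-|p|²)`. -/
def Bmat (p : Euc n) : Matrix (Fin n) (Fin n) ℝ :=
  (1 : Matrix (Fin n) (Fin n) ℝ) +
    (Real.sqrt (1 - ‖p‖ ^ 2) * (1 + Real.sqrt (1 - ‖p‖ ^ 2)))⁻¹ •
      Matrix.vecMulVec (fun i => p i) (fun j => p j)

/-- `A(x) = (1/v)·B(∇u)·D²u·B(∇u)`: its eigenvalues are the principal curvatures. -/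
def Amat (u : Euc n → ℝ) (x : Euc n) : Matrix (Fin n) (Fin n) ℝ :=
  (Real.sqrt (1 - ‖gradient u x‖ ^ 2))⁻¹ •
    (Bmat (gradient u x) * Hess u x * Bmat (gradient u x))

/-- supremum of the quadratic form of `A` over the unit sphere (the operator
norm / largest eigenvalue for a positive semidefinite symmetric `A`). -/
def quadSup (A : Matrix (Fin n) (Fin n) ℝ) : ℝ :=
  ⨆ ξ : Metric.sphere (0 : Euc n) 1,
    (fun i => (ξ : Euc n) i) ⬝ᵥ A.mulVec (fun i => (ξ : Euc n) i)

/-- The domains `Ω = {h̃ > 0}`, `Ω̃ = {h > 0}` are bounded uniformly convex domains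
with smooth boundary, described by the defining functions `h̃` and `h`. -/
def DomainSetup (Ω Ωt : Set (Euc n)) (ht h : Euc n → ℝ) (θt θ : ℝ) : Prop :=
  IsOpen Ω ∧ IsOpen Ωt ∧ Bornology.IsBounded Ω ∧ Bornology.IsBounded Ωt ∧
  Ω.Nonempty ∧ Ωt.Nonempty ∧
  ContDiff ℝ (⊤ : ℕ∞) ht ∧ ContDiff ℝ (⊤ : ℕ∞) h ∧
  Ω = {x | 0 < ht x} ∧ Ωt = {y | 0 < h y} ∧
  (∀ x ∈ frontier Ω, ‖gradient ht x‖ = 1) ∧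
  (∀ y ∈ frontier Ωt, ‖gradient h y‖ = 1) ∧
  0 < θt ∧ 0 < θ ∧
  (∀ x : Euc n, MatLE (Hess ht x) ((-θt) • (1 : Matrix (Fin n) (Fin n) ℝ))) ∧
  (∀ y : Euc n, MatLE (Hess h y) ((-θ) • (1 : Matrix (Fin n) (Fin n) ℝ)))

/-- `f ∈ 𝒜`: `f` is `C²` on `Ω̄ × closure Ω̃` and concave in `x`. -/
def InA (Ω Ωt : Set (Euc n)) (f : Euc n × Euc n → ℝ) : Prop :=
  ContDiffOn ℝ 2 f (closure Ω ×ˢ closure Ωt) ∧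
  ∀ p ∈ closure Ωt, ConcaveOn ℝ (closure Ω) (fun x => f (x, p))

/-- Condition (OSC): `osc f ≤ (n/2)(|Ω̃|/|Ω|)^{1/n}`. -/
def OSCcond (Ω Ωt : Set (Euc n)) (f : Euc n × Euc n → ℝ) : Prop :=
  ∀ x ∈ closure Ω, ∀ y ∈ closure Ω, ∀ p ∈ closure Ωt, ∀ q ∈ closure Ωt,
    |f (x, p) - f (y, q)| ≤
      ((n : ℝ) / 2) * ((volume Ωt).toReal / (volume Ω).toReal) ^ ((1 : ℝ) / n)

/-- `‖f‖_{C²(Ω̄ × closure Ω̃)} ≤ K`. -/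
def C2Bound (Ω Ωt : Set (Euc n)) (f : Euc n × Euc n → ℝ) (K : ℝ) : Prop :=
  ContDiffOn ℝ 2 f (closure Ω ×ˢ closure Ωt) ∧
  ∀ z ∈ closure Ω ×ˢ closure Ωt,
    |f z| ≤ K ∧ ‖fderiv ℝ f z‖ ≤ K ∧ ‖iteratedFDeriv ℝ 2 f z‖ ≤ K

/-- `sup |D_x f| ≤ ε` on `Ω̄ × closure Ω̃`. -/
def DxBound (Ω Ωt : Set (Euc n)) (f : Euc n × Euc n → ℝ) (ε : ℝ) : Prop :=
  ∀ x ∈ closure Ω, ∀ p ∈ closure Ωt, ‖fderiv ℝ (fun x' => f (x', p)) x‖ ≤ ε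

/-- `sup |D_{xp} f| ≤ ε` on `Ω̄ × closure Ω̃`. -/
def DxpBound (Ω Ωt : Set (Euc n)) (f : Euc n × Euc n → ℝ) (ε : ℝ) : Prop :=
  ∀ x ∈ closure Ω, ∀ p ∈ closure Ωt,
    ‖fderiv ℝ (fun p' => fderiv ℝ (fun x' => f (x', p')) x) p‖ ≤ ε

/-- A strictly convex solution of the second boundary value problem. -/
def IsStrictSol (Ω Ωt : Set (Euc n)) (f : Euc n × Euc n → ℝ) (c : ℝ) (u : Euc n → ℝ) : Prop :=
  ContDiffOn ℝ 2 u (closure Ω) ∧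
  (∀ x ∈ closure Ω, (Hess u x).PosDef) ∧
  (∀ x ∈ closure Ω, ‖gradient u x‖ < 1) ∧
  (∀ x ∈ Ω, MinkDiv u x = f (x, gradient u x) + c) ∧
  gradient u '' Ω = Ωt

/-- A smooth uniformly convex solution of the second boundary value problem. -/
def IsSmoothSol (Ω Ωt : Set (Euc n)) (f : Euc n × Euc n → ℝ) (c : ℝ) (u : Euc n → ℝ) : Prop :=
  ContDiffOn ℝ (⊤ : ℕ∞) u (closure Ω) ∧
  (∃ δ : ℝ, 0 < δ ∧ ∀ x ∈ closure Ω, MatLE (δ • (1 : Matrix (Fin n) (Fin n) ℝ)) (Hess u x)) ∧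
  (∀ x ∈ closure Ω, ‖gradient u x‖ < 1) ∧
  (∀ x ∈ Ω, MinkDiv u x = f (x, gradient u x) + c) ∧
  gradient u '' Ω = Ωt

/-- A uniformly convex `C^{2}` solution of the second boundary value problem. -/
def IsUCSol (Ω Ωt : Set (Euc n)) (f : Euc n × Euc n → ℝ) (c : ℝ) (u : Euc n → ℝ) : Prop :=
  ContDiffOn ℝ 2 u (closure Ω) ∧
  (∃ δ : ℝ, 0 < δ ∧ ∀ x ∈ closure Ω, MatLE (δ • (1 : Matrix (Fin n) (Fin n) ℝ)) (Hess u x)) ∧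
  (∀ x ∈ closure Ω, ‖gradient u x‖ < 1) ∧
  (∀ x ∈ Ω, MinkDiv u x = f (x, gradient u x) + c) ∧
  gradient u '' Ω = Ωt

/-- A uniformly convex `C^{4,α}` solution of the second boundary value problem
for the Minkowski mean-curvature operator. -/
def IsC4Sol (Ω Ωt : Set (Euc n)) (f : Euc n × Euc n → ℝ) (c : ℝ) (u : Euc n → ℝ)
    (α : ℝ) : Prop :=
  ContDiffOn ℝ 4 u (closure Ω) ∧
  (∃ C : ℝ≥0, HolderOnWith C (Real.toNNReal α) (fun x => iteratedFDeriv ℝ 4 u x) (closure Ω)) ∧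
  (∃ δ : ℝ, 0 < δ ∧ ∀ x ∈ closure Ω, MatLE (δ • (1 : Matrix (Fin n) (Fin n) ℝ)) (Hess u x)) ∧
  (∀ x ∈ closure Ω, ‖gradient u x‖ < 1) ∧
  (∀ x ∈ Ω, MinkDiv u x = f (x, gradient u x) + c) ∧
  gradient u '' Ω = Ωt

/-- A uniformly convex `C^{4,α}` solution of the second boundary value problem
for the Euclidean mean-curvature operator. -/
def IsC4SolE (Ω Ωt : Set (Euc n)) (f : Euc n × Euc n → ℝ) (c : ℝ) (u : Euc n → ℝ)
    (α : ℝ) : Prop :=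
  ContDiffOn ℝ 4 u (closure Ω) ∧
  (∃ C : ℝ≥0, HolderOnWith C (Real.toNNReal α) (fun x => iteratedFDeriv ℝ 4 u x) (closure Ω)) ∧
  (∃ δ : ℝ, 0 < δ ∧ ∀ x ∈ closure Ω, MatLE (δ • (1 : Matrix (Fin n) (Fin n) ℝ)) (Hess u x)) ∧
  (∀ x ∈ Ω, EucDiv u x = f (x, gradient u x) + c) ∧
  gradient u '' Ω = Ωt

/-- `ũ` is the Legendre transform of `u`. -/
def IsLegendre (Ω Ωt : Set (Euc n)) (u ut : Euc n → ℝ) : Prop :=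
  ContDiffOn ℝ (⊤ : ℕ∞) ut (closure Ωt) ∧
  (∀ x ∈ closure Ω, ut (gradient u x) = ⟪x, gradient u x⟫ - u x) ∧
  (∀ x ∈ closure Ω, gradient ut (gradient u x) = x) ∧
  (∀ x ∈ closure Ω, Hess ut (gradient u x) = (Hess u x)⁻¹)

theorem dotProduct_Hess_mulVec (u : Euc n → ℝ) (x v : Euc n) :
    (v : Fin n → ℝ) ⬝ᵥ (Hess u x *ᵥ (v : Fin n → ℝ)) = fderiv ℝ (fderiv ℝ u) x v v := by
  have hv : v = ∑ i, v i • EuclideanSpace.single i (1 : ℝ) := by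
    ext j
    simp [Finset.sum_apply, Pi.single_apply]
  conv_rhs => rw [hv]
  simp only [map_sum, map_smul, _root_.sum_apply, _root_.smul_apply,
    smul_eq_mul, dotProduct, mulVec, Hess, iteratedFDeriv_two_apply, Finset.mul_sum]
  rw [Finset.sum_comm]
  refine Finset.sum_congr rfl fun i _ => Finset.sum_congr rfl fun j _ => ?_
  simp only [cons_val_zero, cons_val_one]
  ring

theorem dotProduct_smul_one_mulVec (δ : ℝ) (v : Euc n) :
    (v : Fin n → ℝ) ⬝ᵥ ((δ • (1 : Matrix (Fin n) (Fin n) ℝ)) *ᵥ (v : Fin n → ℝ)) =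
      δ * ‖v‖ ^ 2 := by
  rw [smul_mulVec, one_mulVec, dotProduct_smul, smul_eq_mul, EuclideanSpace.norm_sq_eq]
  simp [dotProduct, pow_two]

theorem MatLE.dotProduct_mulVec_le {A B : Matrix (Fin n) (Fin n) ℝ} (hAB : MatLE A B)
    (v : Fin n → ℝ) : v ⬝ᵥ (A *ᵥ v) ≤ v ⬝ᵥ (B *ᵥ v) := by
  have := hAB.dotProduct_mulVec_nonneg v
  rw [star_trivial, sub_mulVec, dotProduct_sub] at this
  linarith

/-- The second derivative dominates a lower bound of the Hessian matrix. -/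
theorem MatLE.mul_norm_sq_le_fderiv_fderiv {u : Euc n → ℝ} {x : Euc n} {δ : ℝ}
    (hδ : MatLE (δ • (1 : Matrix (Fin n) (Fin n) ℝ)) (Hess u x)) (v : Euc n) :
    δ * ‖v‖ ^ 2 ≤ fderiv ℝ (fderiv ℝ u) x v v := by
  rw [← dotProduct_Hess_mulVec, ← dotProduct_smul_one_mulVec]
  exact hδ.dotProduct_mulVec_le v

/-- A positive lower bound of the Hessian rules out the junk value of the second derivative. -/
theorem MatLE.differentiableAt_fderiv (hn : 0 < n) {u : Euc n → ℝ} {x : Euc n} {δ : ℝ}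
    (hδ0 : 0 < δ) (hδ : MatLE (δ • (1 : Matrix (Fin n) (Fin n) ℝ)) (Hess u x)) :
    DifferentiableAt ℝ (fderiv ℝ u) x := by
  by_contra hnd
  have := hδ.mul_norm_sq_le_fderiv_fderiv (EuclideanSpace.single ⟨0, hn⟩ 1)
  rw [fderiv_zero_of_not_differentiableAt hnd] at this
  simp at this
  linarith

theorem differentiableAt_gradient {u : Euc n → ℝ} {x : Euc n}
    (hx : DifferentiableAt ℝ (fderiv ℝ u) x) : DifferentiableAt ℝ (gradient u) x := by
  rw [differentiableAt_euclidean]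
  intro i
  have hi : (fun y => gradient u y i) =
      fun y => fderiv ℝ u y (EuclideanSpace.single i 1) := by
    ext y
    rw [← inner_gradient_left, EuclideanSpace.inner_single_right]
    simp
  rw [hi]
  exact hx.clm_apply (differentiableAt_const _)

theorem inner_fderiv_gradient {u : Euc n → ℝ} {x : Euc n}
    (hx : DifferentiableAt ℝ (fderiv ℝ u) x) (v w : Euc n) :
    ⟪fderiv ℝ (gradient u) x v, w⟫ = fderiv ℝ (fderiv ℝ u) x v w := by
  have h₁ : HasFDerivAt (fun y => ⟪w, gradient u y⟫)
      ((innerSL ℝ w).comp (fderiv ℝ (gradient u) x)) x :=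
    (innerSL ℝ w).hasFDerivAt.comp x (differentiableAt_gradient hx).hasFDerivAt
  have h₂ := hx.hasFDerivAt.clm_apply (hasFDerivAt_const w x)
  have heq : (fun y => ⟪w, gradient u y⟫) = fun y => fderiv ℝ u y w := by
    ext y
    rw [real_inner_comm, inner_gradient_left]
  rw [heq] at h₁
  have := congrArg (fun L : Euc n →L[ℝ] ℝ => L v) (h₁.unique h₂)
  rw [real_inner_comm]
  simpa using this

theorem hasDerivAt_add_smul (a v : Euc n) (t : ℝ) :
    HasDerivAt (fun s : ℝ => a + s • v) v t := by
  simpa using ((hasDerivAt_id t).smul_const v).const_add a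

theorem hasDerivAt_fderiv_add_smul {u : Euc n → ℝ} {a v : Euc n} {t : ℝ}
    (hx : DifferentiableAt ℝ (fderiv ℝ u) (a + t • v)) :
    HasDerivAt (fun s : ℝ => fderiv ℝ u (a + s • v) v)
      (fderiv ℝ (fderiv ℝ u) (a + t • v) v v) t := by
  have h₁ := hx.hasFDerivAt.comp_hasDerivAt t (hasDerivAt_add_smul a v t)
  simpa using h₁.clm_apply (hasDerivAt_const t v)

/-- Superlevel sets of a function with nonpositive second derivative are convex. -/
theorem convex_superlevel_of_fderiv_fderiv_nonpos {g : Euc n → ℝ} (hg : ContDiff ℝ 2 g)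
    (hneg : ∀ x v, fderiv ℝ (fderiv ℝ g) x v v ≤ 0) : Convex ℝ {x | 0 < g x} := by
  have hg' : Differentiable ℝ (fderiv ℝ g) :=
    (hg.fderiv_right (m := 1) (by norm_num)).differentiable (by norm_num)
  rw [convex_iff_segment_subset]
  intro a ha b hb
  rw [segment_eq_image']
  rintro _ ⟨t, ht, rfl⟩
  have hd : ∀ s : ℝ, HasDerivAt (fun s : ℝ => g (a + s • (b - a)))
      (fderiv ℝ g (a + s • (b - a)) (b - a)) s := fun s =>
    ((hg.differentiable (by norm_num)) _).hasFDerivAt.comp_hasDerivAt s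
      (hasDerivAt_add_smul a (b - a) s)
  have hderiv : deriv (fun s : ℝ => g (a + s • (b - a))) =
      fun s => fderiv ℝ g (a + s • (b - a)) (b - a) := funext fun s => (hd s).deriv
  have hd2 : ∀ s : ℝ, HasDerivAt (deriv fun s : ℝ => g (a + s • (b - a)))
      (fderiv ℝ (fderiv ℝ g) (a + s • (b - a)) (b - a) (b - a)) s := by
    intro s
    rw [hderiv]
    exact hasDerivAt_fderiv_add_smul (hg' _)
  have hconc : ConcaveOn ℝ univ (fun s : ℝ => g (a + s • (b - a))) := by
    refine concaveOn_univ_of_deriv2_nonpos (fun s => (hd s).differentiableAt)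
      (fun s => (hd2 s).differentiableAt) fun s => ?_
    change deriv (deriv _) s ≤ 0
    rw [(hd2 s).deriv]
    exact hneg _ _
  have hmem := (hconc.convex_gt 0).segment_subset (x := 0) (y := 1)
    ⟨mem_univ _, by simpa using ha⟩ ⟨mem_univ _, by simpa using hb⟩
  rw [segment_eq_Icc zero_le_one] at hmem
  exact (hmem ht).2

/-- The gradient is injective on a convex set where the second derivative is positive definite. -/
theorem injOn_gradient {u : Euc n → ℝ} {s : Set (Euc n)} (hs : Convex ℝ s)
    (hd : ∀ x ∈ s, DifferentiableAt ℝ (fderiv ℝ u) x)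
    (hpos : ∀ x ∈ s, ∀ v ≠ 0, 0 < fderiv ℝ (fderiv ℝ u) x v v) :
    InjOn (gradient u) s := by
  intro a ha b hb hab
  by_contra hne
  have hseg : ∀ t ∈ Icc (0 : ℝ) 1, a + t • (b - a) ∈ s := fun t ht =>
    hs.add_smul_sub_mem ha hb ht
  have hder : ∀ t ∈ Icc (0 : ℝ) 1, HasDerivAt (fun r : ℝ => fderiv ℝ u (a + r • (b - a)) (b - a))
      (fderiv ℝ (fderiv ℝ u) (a + t • (b - a)) (b - a) (b - a)) t := fun t ht =>
    hasDerivAt_fderiv_add_smul (hd _ (hseg t ht))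
  have hmono : StrictMonoOn (fun r : ℝ => fderiv ℝ u (a + r • (b - a)) (b - a))
      (Icc (0 : ℝ) 1) :=
    strictMonoOn_of_hasDerivWithinAt_pos (convex_Icc 0 1)
      (fun t ht => (hder t ht).continuousAt.continuousWithinAt)
      (fun t ht => (hder t (interior_subset ht)).hasDerivWithinAt)
      (fun t ht => hpos _ (hseg t (interior_subset ht)) _ (sub_ne_zero.mpr (Ne.symm hne)))
  have hlt := hmono (left_mem_Icc.mpr zero_le_one) (right_mem_Icc.mpr zero_le_one) zero_lt_one
  simp only [zero_smul, add_zero, one_smul, add_sub_cancel] at hlt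
  rw [← inner_gradient_left, ← inner_gradient_left, hab] at hlt
  exact lt_irrefl _ hlt

theorem HasDerivAt.eventually_pos_right {φ : ℝ → ℝ} {d : ℝ} (hφ : HasDerivAt φ d 0)
    (h0 : φ 0 = 0) (hd : 0 < d) : ∀ᶠ t in 𝓝[>] (0 : ℝ), 0 < φ t := by
  have hslope := (hasDerivAt_iff_tendsto_slope.mp hφ).mono_left
    (nhdsWithin_mono (0 : ℝ) fun t (ht : 0 < t) => ht.ne')
  filter_upwards [hslope.eventually (lt_mem_nhds hd), self_mem_nhdsWithin] with t ht htpos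
  have htpos : 0 < t := htpos
  simp only [slope_def_field, h0, sub_zero] at ht
  exact (div_pos_iff_of_pos_right htpos).mp ht

theorem statement_8 {n : ℕ} (hn : 2 ≤ n)
    (Ω Ωt : Set (Euc n)) (ht h : Euc n → ℝ) (θt θ : ℝ)
    (hdom : DomainSetup Ω Ωt ht h θt θ)
    (hball : closure Ωt ⊆ Metric.ball (0 : Euc n) 1)
    (f : Euc n × Euc n → ℝ) (c : ℝ)
    (hf : ContDiffOn ℝ 2 f (closure Ω ×ˢ closure Ωt))
    (u : Euc n → ℝ) (hu : IsSmoothSol Ω Ωt f c u) :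
    ∀ x ∈ frontier Ω, 0 ≤ ⟪gradient h (gradient u x), gradient ht x⟫ := by
  obtain ⟨hΩo, -, -, -, -, -, hht, hh, hΩ, hΩt, -, -, hθt, -, hHt, -⟩ := hdom
  obtain ⟨-, ⟨δ, hδ, hHess⟩, -, -, himg⟩ := hu
  have hd : ∀ x ∈ closure Ω, DifferentiableAt ℝ (fderiv ℝ u) x := fun x hx =>
    (hHess x hx).differentiableAt_fderiv (by omega) hδ
  have hpos : ∀ x ∈ closure Ω, ∀ v ≠ 0, 0 < fderiv ℝ (fderiv ℝ u) x v v := fun x hx v hv =>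
    lt_of_lt_of_le (by positivity) ((hHess x hx).mul_norm_sq_le_fderiv_fderiv v)
  have hconv : Convex ℝ Ω := by
    rw [hΩ]
    refine convex_superlevel_of_fderiv_fderiv_nonpos (contDiff_infty.mp hht 2)
      fun x v => ?_
    have := (hHt x).dotProduct_mulVec_le v
    rw [dotProduct_Hess_mulVec, dotProduct_smul_one_mulVec] at this
    nlinarith [sq_nonneg ‖v‖]
  intro x hx
  have hxc : x ∈ closure Ω := hx.1
  have hxΩ : x ∉ Ω := by rw [← hΩo.interior_eq]; exact hx.2
  have hht0 : ht x = 0 := by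
    refine le_antisymm (by simpa [hΩ] using hxΩ) ?_
    exact closure_minimal (t := {y | 0 ≤ ht y}) (hΩ ▸ fun y (hy : 0 < ht y) => hy.le)
      (isClosed_le continuous_const hht.continuous) hxc
  have hG := differentiableAt_gradient (hd x hxc)
  have hGcl : gradient u x ∈ closure Ωt := by
    rw [← himg]
    exact mem_closure_image hG.continuousAt hxc
  have hGΩt : gradient u x ∉ Ωt := by
    rw [← himg]
    rintro ⟨y, hy, hyx⟩
    exact hxΩ (injOn_gradient hconv.closure hd hpos (subset_closure hy) hxc hyx ▸ hy)
  have hh0 : h (gradient u x) = 0 := by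
    refine le_antisymm (by simpa [hΩt] using hGΩt) ?_
    exact closure_minimal (t := {y | 0 ≤ h y}) (hΩt ▸ fun y (hy : 0 < h y) => hy.le)
      (isClosed_le continuous_const hh.continuous) hGcl
  by_contra! hneg
  set w := gradient h (gradient u x) with hw
  have hw0 : w ≠ 0 := by
    rintro h0
    rw [h0, inner_zero_left] at hneg
    exact lt_irrefl _ hneg
  have hline := hasDerivAt_add_smul x (-w) 0
  have hx0 : x = x + (0 : ℝ) • (-w) := by simp
  have hinto : HasDerivAt (fun t : ℝ => ht (x + t • (-w))) (fderiv ℝ ht x (-w)) 0 :=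
    HasFDerivAt.comp_hasDerivAt_of_eq 0
      (hht.differentiable (by simp) x).hasFDerivAt hline hx0
  have hcomp : HasDerivAt (fun t : ℝ => h (gradient u (x + t • (-w))))
      (fderiv ℝ h (gradient u x) (fderiv ℝ (gradient u) x (-w))) 0 :=
    HasFDerivAt.comp_hasDerivAt_of_eq 0
      (hh.differentiable (by simp) (gradient u x)).hasFDerivAt
      (HasFDerivAt.comp_hasDerivAt_of_eq 0 hG.hasFDerivAt hline hx0) (by rw [← hx0])
  have hin := hinto.eventually_pos_right (by simpa using hht0) (by
    rw [map_neg, ← inner_gradient_left, real_inner_comm]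
    linarith)
  have hout := hcomp.neg.eventually_pos_right (by simpa using hh0) (by
    rw [map_neg, map_neg, neg_neg, ← inner_gradient_left, ← hw, real_inner_comm,
      inner_fderiv_gradient (hd x hxc)]
    exact hpos x hxc w hw0)
  obtain ⟨t, htin, htout⟩ := (hin.and hout).exists
  have hmem : gradient u (x + t • (-w)) ∈ Ωt :=
    himg ▸ mem_image_of_mem _ (by rw [hΩ]; exact htin)
  rw [hΩt] at hmem
  have hmem : 0 < h (gradient u (x + t • (-w))) := hmem
  have htout : 0 < -h (gradient u (x + t • (-w))) := htout
  linarith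

end
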